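/- arXiv:2201.12087 — 2 statements merged into one kernel-verified Lean document; each statement's English description precedes it below -/
import Mathlib

section
/- Let X be any real-valued random variable and let Y be a continuous real-valued random variable with probability density function p satisfying p(y) ≤ A for all y ∈ ℝ, for some constant A > 0. Let m ≥ 1 and suppose that d_m(X,Y) ≤ A/(2 N_m). Then d_K(X,Y) ≤ 2 (A^m M_m d_m(X,Y))^{1/(m+1)}. -/
open MeasureTheory ProbabilityTheory Real
open scoped NNReal

/-- `M_m = 2^(m-2) (m-1)!` -/
noncomputable def Mc (m : ℕ) : ℝ := (2 : ℝ) ^ ((m : ℤ) - 2) * (Nat.factorial (m - 1) : ℝ)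

/-- `N_m = 2^m M_m` -/
noncomputable def Nc (m : ℕ) : ℝ := 2 ^ m * Mc m

/-- The test functions for the smooth Wasserstein distance `d_m`: `h^(m-1)` is Lipschitz
(with Lipschitz constant, i.e. `‖h^(m)‖`, at most 1) and `‖h^(j)‖ ≤ 1` for `0 ≤ j ≤ m-1`. -/
def testFun (m : ℕ) (h : ℝ → ℝ) : Prop :=
  ContDiff ℝ (↑(m - 1)) h ∧
  (∀ j ≤ m - 1, ∀ x : ℝ, |iteratedDeriv j h x| ≤ 1) ∧
  LipschitzWith 1 (iteratedDeriv (m - 1) h)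

/-- The smooth Wasserstein distance `d_m` between two distributions on `ℝ`. -/
noncomputable def dSm (m : ℕ) (μ ν : Measure ℝ) : ℝ :=
  ⨆ h : {h : ℝ → ℝ // testFun m h}, |(∫ x, h.1 x ∂μ) - ∫ x, h.1 x ∂ν|

/-- The Kolmogorov distance between two distributions on `ℝ`. -/
noncomputable def dKol (μ ν : Measure ℝ) : ℝ :=
  ⨆ z : ℝ, |(μ (Set.Iic z)).toReal - (ν (Set.Iic z)).toReal|

/-- The truncated power `u ↦ u₊ ^ n`, where `u₊ ^ 0` is the indicator of `0 < u`. -/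
noncomputable def truncPow (n : ℕ) (u : ℝ) : ℝ := if 0 < u then u ^ n else 0

lemma mul_truncPow (n : ℕ) (u : ℝ) : u * truncPow n u = truncPow (n + 1) u := by
  unfold truncPow; split_ifs <;> ring

lemma truncPow_of_nonneg {n : ℕ} {u : ℝ} (hu : 0 ≤ u) : truncPow (n + 1) u = u ^ (n + 1) := by
  rcases hu.eq_or_lt with rfl | h
  · simp [truncPow]
  · simp [truncPow, h]

lemma truncPow_of_nonpos {n : ℕ} {u : ℝ} (hu : u ≤ 0) : truncPow n u = 0 := by
  simp [truncPow, hu.not_gt]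

lemma truncPow_add_neg (n : ℕ) (u : ℝ) :
    truncPow (n + 1) u + (-1) ^ (n + 1) * truncPow (n + 1) (-u) = u ^ (n + 1) := by
  rcases le_total 0 u with h | h
  · rw [truncPow_of_nonneg h, truncPow_of_nonpos (neg_nonpos.2 h)]; simp
  · rw [truncPow_of_nonpos h, truncPow_of_nonneg (neg_nonneg.2 h), ← mul_pow]; simp

lemma hasDerivAt_truncPow (n : ℕ) (u : ℝ) :
    HasDerivAt (truncPow (n + 2)) ((n + 2) * truncPow (n + 1) u) u := by
  rcases lt_trichotomy u 0 with h | rfl | h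
  · rw [truncPow_of_nonpos h.le, mul_zero]
    refine (hasDerivAt_const u (0 : ℝ)).congr_of_eventuallyEq ?_
    filter_upwards [eventually_lt_nhds h] with y hy using truncPow_of_nonpos hy.le
  · rw [truncPow_of_nonpos le_rfl, mul_zero, hasDerivAt_iff_isLittleO]
    have h0 : truncPow (n + 2) 0 = 0 := truncPow_of_nonpos le_rfl
    simp only [sub_zero, smul_zero, h0]
    refine Asymptotics.IsBigO.trans_isLittleO (g := fun y : ℝ => y ^ (n + 2)) ?_ ?_
    · refine Asymptotics.isBigO_of_le _ fun y => ?_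
      unfold truncPow
      split_ifs <;> simp
    · simpa using Asymptotics.isLittleO_pow_pow (𝕜 := ℝ) (m := 1) (n := n + 2) (by omega)
  · rw [truncPow_of_nonneg h.le]
    have := hasDerivAt_pow (n + 2) u
    push_cast at this
    refine this.congr_of_eventuallyEq ?_
    filter_upwards [eventually_gt_nhds h] with y hy using truncPow_of_nonneg hy.le

lemma continuous_truncPow (n : ℕ) : Continuous (truncPow (n + 1)) := by
  have : truncPow (n + 1) = fun u => (max u 0) ^ (n + 1) := by
    funext u
    rcases le_total 0 u with h | h
    · rw [truncPow_of_nonneg h, max_eq_left h]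
    · rw [truncPow_of_nonpos h, max_eq_right h]; simp
  rw [this]; fun_prop

lemma hasDerivWithinAt_truncPow_sub (n : ℕ) (t x : ℝ) :
    HasDerivWithinAt (fun y => truncPow (n + 1) (t - y)) (-((n + 1) * truncPow n (t - x)))
      (Set.Ici x) x := by
  rcases n with _ | n
  · rcases lt_or_ge x t with h | h
    · have : HasDerivAt (fun y => t - y) (-1) x := by
        simpa using (hasDerivAt_id x).const_sub t
      have h2 : truncPow 0 (t - x) = 1 := by simp [truncPow, h]
      rw [h2]
      simp only [Nat.cast_zero, zero_add, mul_one]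
      refine (this.congr_of_eventuallyEq ?_).hasDerivWithinAt
      filter_upwards [eventually_lt_nhds h] with y hy
      rw [← zero_add 1, truncPow_of_nonneg (by linarith), zero_add, pow_one]
    · rw [truncPow_of_nonpos (by linarith)]
      simp only [mul_zero, neg_zero]
      refine (hasDerivWithinAt_const x _ (0 : ℝ)).congr ?_ (truncPow_of_nonpos (by linarith))
      intro y hy
      have : x ≤ y := hy
      exact truncPow_of_nonpos (by linarith)
  · have h1 := (hasDerivAt_truncPow n (t - x)).comp x ((hasDerivAt_id x).const_sub t)
    refine (h1.congr_deriv ?_).hasDerivWithinAt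
    push_cast; ring

section Spline

variable {ι : Type*} [DecidableEq ι]

/-- The divided difference at the points `v i`, `i ∈ s`, of `t ↦ (t - x)₊ ^ n`. -/
noncomputable def truncSpline (s : Finset ι) (v : ι → ℝ) (n : ℕ) (x : ℝ) : ℝ :=
  ∑ i ∈ s, Lagrange.nodalWeight s v i * truncPow n (v i - x)

lemma sum_nodalWeight_mul_sub_pow {s : Finset ι} {v : ι → ℝ} (hv : Set.InjOn v s) {n m : ℕ}
    (hs : s.card = m + 1) (hn : n ≤ m) (x : ℝ) :
    ∑ i ∈ s, Lagrange.nodalWeight s v i * (v i - x) ^ n = if n = m then 1 else 0 := by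
  have hm := Polynomial.monic_X_sub_C x |>.pow n
  have hd : ((Polynomial.X - Polynomial.C x) ^ n).natDegree = n := by simp
  have h := Lagrange.coeff_eq_sum (P := (Polynomial.X - Polynomial.C x) ^ n) hv (by
    rw [Polynomial.degree_pow, Polynomial.degree_X_sub_C, hs]
    simp only [nsmul_eq_mul, mul_one]; exact_mod_cast Nat.lt_succ_of_le hn)
  rw [hs, Nat.add_sub_cancel] at h
  trans ((Polynomial.X - Polynomial.C x) ^ n).coeff m
  · rw [h]
    refine Finset.sum_congr rfl fun i _ => ?_
    simp [Lagrange.nodalWeight, div_eq_inv_mul]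
  · split_ifs with hnm
    · subst hnm
      nth_rewrite 2 [← hd]
      exact hm
    · exact Polynomial.coeff_eq_zero_of_natDegree_lt (by omega)

lemma nodalWeight_mul_sub {s : Finset ι} {v : ι → ℝ} (hv : Set.InjOn v s) {a i : ι} (ha : a ∈ s)
    (hi : i ∈ s.erase a) :
    Lagrange.nodalWeight s v i * (v i - v a) = Lagrange.nodalWeight (s.erase a) v i := by
  obtain ⟨hia, his⟩ := Finset.mem_erase.1 hi
  have h0 : v i - v a ≠ 0 := sub_ne_zero.2 fun h => hia (hv his ha h)
  unfold Lagrange.nodalWeight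
  rw [Finset.erase_right_comm,
    ← Finset.mul_prod_erase (s.erase i) _ (Finset.mem_erase.2 ⟨hia.symm, ha⟩)]
  field_simp

lemma sum_erase_nodalWeight_mul {s : Finset ι} {v : ι → ℝ} (hv : Set.InjOn v s) {a : ι}
    (ha : a ∈ s) (g : ι → ℝ) :
    ∑ i ∈ s.erase a, Lagrange.nodalWeight (s.erase a) v i * g i =
      ∑ i ∈ s, Lagrange.nodalWeight s v i * ((v i - v a) * g i) := by
  rw [← Finset.add_sum_erase s _ ha, sub_self, zero_mul, mul_zero, zero_add]
  refine Finset.sum_congr rfl fun i hi => ?_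
  rw [← nodalWeight_mul_sub hv ha hi, mul_assoc]

lemma truncSpline_succ {s : Finset ι} {v : ι → ℝ} (hv : Set.InjOn v s) {a b : ι} (ha : a ∈ s)
    (hb : b ∈ s) (n : ℕ) (x : ℝ) :
    (v b - v a) * truncSpline s v (n + 1) x =
      (v b - x) * truncSpline (s.erase a) v n x + (x - v a) * truncSpline (s.erase b) v n x := by
  simp only [truncSpline, sum_erase_nodalWeight_mul hv ha, sum_erase_nodalWeight_mul hv hb,
    Finset.mul_sum, ← Finset.sum_add_distrib, ← mul_truncPow]
  exact Finset.sum_congr rfl fun i _ => by ring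

lemma truncSpline_of_le {s : Finset ι} {v : ι → ℝ} {x : ℝ} (h : ∀ i ∈ s, v i ≤ x) (n : ℕ) :
    truncSpline s v n x = 0 :=
  Finset.sum_eq_zero fun i hi => by rw [truncPow_of_nonpos (by linarith [h i hi]), mul_zero]

lemma truncSpline_of_ge {s : Finset ι} {v : ι → ℝ} (hv : Set.InjOn v s) {n m : ℕ}
    (hs : s.card = m + 1) (hn : n + 1 ≤ m) {x : ℝ} (h : ∀ i ∈ s, x ≤ v i) :
    truncSpline s v (n + 1) x = if n + 1 = m then 1 else 0 := by
  rw [← sum_nodalWeight_mul_sub_pow hv hs hn x]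
  exact Finset.sum_congr rfl fun i hi => by rw [truncPow_of_nonneg (by linarith [h i hi])]

lemma truncSpline_mem_Icc {n : ℕ} {s : Finset ι} {v : ι → ℝ} (hv : Set.InjOn v s)
    (hs : s.card = n + 1) (x : ℝ) : truncSpline s v n x ∈ Set.Icc 0 1 := by
  induction n generalizing s with
  | zero =>
    obtain ⟨a, rfl⟩ := Finset.card_eq_one.1 hs
    simp only [truncSpline, Lagrange.nodalWeight, truncPow, Finset.sum_singleton]
    split_ifs <;> simp
  | succ n ih =>
    have hne : s.Nonempty := Finset.card_pos.1 (by omega)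
    obtain ⟨a, ha, hmin⟩ := s.exists_min_image v hne
    obtain ⟨b, hb, hmax⟩ := s.exists_max_image v hne
    rcases le_total x (v a) with hxa | hxa
    · rw [truncSpline_of_ge hv hs le_rfl fun i hi => hxa.trans (hmin i hi)]
      simp
    rcases le_total (v b) x with hxb | hxb
    · rw [truncSpline_of_le fun i hi => (hmax i hi).trans hxb]
      simp
    have hab : v a < v b := by
      refine (hmin b hb).lt_of_ne fun h => ?_
      have : s.card ≤ 1 := Finset.card_le_one.2 fun i hi j hj => hv hi hj <| by
        linarith [hmin i hi, hmin j hj, hmax i hi, hmax j hj]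
      omega
    have hA := ih (s := s.erase a) (hv.mono (by simp)) (by rw [Finset.card_erase_of_mem ha]; omega)
    have hB := ih (s := s.erase b) (hv.mono (by simp)) (by rw [Finset.card_erase_of_mem hb]; omega)
    have key := truncSpline_succ hv ha hb n x
    constructor
    · refine nonneg_of_mul_nonneg_right (key ▸ ?_) (sub_pos.2 hab)
      have := mul_nonneg (sub_nonneg.2 hxb) hA.1
      have := mul_nonneg (sub_nonneg.2 hxa) hB.1
      positivity
    · refine le_of_mul_le_mul_left (key.trans_le ?_) (sub_pos.2 hab)
      nlinarith [mul_le_mul_of_nonneg_left hA.2 (sub_nonneg.2 hxb),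
        mul_le_mul_of_nonneg_left hB.2 (sub_nonneg.2 hxa)]

lemma hasDerivAt_truncSpline (s : Finset ι) (v : ι → ℝ) (n : ℕ) (x : ℝ) :
    HasDerivAt (truncSpline s v (n + 2)) (-((n + 2) * truncSpline s v (n + 1) x)) x := by
  have : HasDerivAt (fun y => ∑ i ∈ s, Lagrange.nodalWeight s v i * truncPow (n + 2) (v i - y))
      (∑ i ∈ s, Lagrange.nodalWeight s v i * ((n + 2) * truncPow (n + 1) (v i - x) * -1)) x :=
    HasDerivAt.fun_sum fun i _ => ((hasDerivAt_truncPow n (v i - x)).comp x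
      ((hasDerivAt_id x).const_sub (v i))).const_mul _
  refine this.congr_deriv ?_
  rw [truncSpline, Finset.mul_sum, ← Finset.sum_neg_distrib]
  exact Finset.sum_congr rfl fun i _ => by ring

lemma continuous_truncSpline (s : Finset ι) (v : ι → ℝ) (n : ℕ) :
    Continuous (truncSpline s v (n + 1)) :=
  continuous_finsetSum _ fun _ _ => continuous_const.mul
    ((continuous_truncPow n).comp (continuous_const.sub continuous_id))

lemma abs_truncSpline_sub_le {s : Finset ι} {v : ι → ℝ} {n : ℕ} {C : ℝ}
    (hC : ∀ x, |truncSpline s v n x| ≤ C) (x y : ℝ) :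
    |truncSpline s v (n + 1) x - truncSpline s v (n + 1) y| ≤ (n + 1) * C * |x - y| := by
  wlog hyx : y ≤ x generalizing x y
  · rw [abs_sub_comm, abs_sub_comm x]
    exact this y x (le_of_not_ge hyx)
  rw [abs_of_nonneg (sub_nonneg.2 hyx)]
  refine norm_image_sub_le_of_norm_deriv_right_le_segment (a := y) (b := x)
    (f' := fun z => -((n + 1) * truncSpline s v n z))
    (continuous_truncSpline s v n).continuousOn (fun z _ => ?_) (fun z _ => ?_) x ⟨hyx, le_rfl⟩
  · have : HasDerivWithinAt
        (fun y => ∑ i ∈ s, Lagrange.nodalWeight s v i * truncPow (n + 1) (v i - y))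
        (∑ i ∈ s, Lagrange.nodalWeight s v i * -((n + 1) * truncPow n (v i - z))) (Set.Ici z) z :=
      HasDerivWithinAt.fun_sum fun i _ => (hasDerivWithinAt_truncPow_sub n (v i) z).const_mul _
    refine this.congr_deriv ?_
    rw [truncSpline, Finset.mul_sum, ← Finset.sum_neg_distrib]
    exact Finset.sum_congr rfl fun i _ => by ring
  · rw [norm_neg, norm_mul, Real.norm_eq_abs, Real.norm_eq_abs,
      abs_of_nonneg (by positivity : (0 : ℝ) ≤ n + 1)]
    exact mul_le_mul_of_nonneg_left (hC z) (by positivity)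

lemma abs_truncSpline_le {s : Finset ι} {v : ι → ℝ} (hv : Set.InjOn v s) {m : ℕ}
    (hs : s.card = m + 1) (hmem : ∀ i ∈ s, v i ∈ Set.Icc (-1) 1) {C : ℝ} (hC0 : 0 ≤ C)
    (hC : ∀ x, |truncSpline s v 0 x| ≤ C) {n : ℕ} (hn : n < m) (x : ℝ) :
    |truncSpline s v n x| ≤ 2 ^ n * n.factorial * C := by
  induction n generalizing x with
  | zero => simpa using hC x
  | succ n ih =>
    have hpos : 0 ≤ 2 ^ (n + 1) * (n + 1).factorial * C := by positivity
    rcases le_total x (-1) with h1 | h1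
    · rw [truncSpline_of_ge hv hs hn.le fun i hi => h1.trans (hmem i hi).1, if_neg hn.ne]
      simpa using hpos
    rcases le_total 1 x with h2 | h2
    · rw [truncSpline_of_le fun i hi => (hmem i hi).2.trans h2]
      simpa using hpos
    have h := abs_truncSpline_sub_le (ih (by omega)) x 1
    rw [truncSpline_of_le (x := 1) fun i hi => (hmem i hi).2, sub_zero] at h
    have h3 : |x - 1| ≤ 2 := by rw [abs_le]; constructor <;> linarith
    calc _ ≤ _ := h
      _ ≤ (n + 1) * (2 ^ n * n.factorial * C) * 2 := by gcongr
      _ = _ := by rw [Nat.factorial_succ]; push_cast; ring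

end Spline

open Polynomial Polynomial.Chebyshev in
lemma node_sq_sub_one_mul_eval_U (k i : ℕ) :
    ((node (k + 1) i) ^ 2 - 1) * (U ℝ (k : ℤ)).eval (node (k + 1) i) = 0 := by
  have h := U_real_cos (i * π / ((k + 1 : ℕ) : ℝ)) (k : ℤ)
  have h2 : (((k : ℤ) : ℝ) + 1) * (i * π / ((k + 1 : ℕ) : ℝ)) = i * π := by
    push_cast; field_simp
  rw [h2, sin_nat_mul_pi] at h
  unfold node
  rw [cos_sq']
  linear_combination (-sin (i * π / ((k + 1 : ℕ) : ℝ))) * h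

open Polynomial Polynomial.Chebyshev in
lemma C_mul_nodal_node (k : ℕ) :
    C ((2 : ℝ) ^ k) * Lagrange.nodal (Finset.range (k + 2)) (node (k + 1)) =
      (X ^ 2 - 1) * U ℝ (k : ℤ) := by
  have hX : ((X : ℝ[X]) ^ 2 - 1).degree = 2 :=
    degree_X_pow_sub_C (R := ℝ) (n := 2) two_pos 1
  have hXl : ((X : ℝ[X]) ^ 2 - 1).leadingCoeff = 1 :=
    leadingCoeff_X_pow_sub_C (R := ℝ) (n := 2) two_pos (r := 1)
  have hdl : (C ((2 : ℝ) ^ k) * Lagrange.nodal (Finset.range (k + 2)) (node (k + 1))).degree =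
      ((k + 2 : ℕ) : WithBot ℕ) := by
    rw [degree_C_mul (by positivity), Lagrange.degree_nodal, Finset.card_range]
  refine Polynomial.eq_of_degree_le_of_eval_index_eq (Finset.range (k + 2))
    (strictAntiOn_node (k + 1)).injOn ?_ ?_ ?_ ?_
  · rw [hdl, Finset.card_range]
  · rw [hdl, degree_mul, hX, degree_U_natCast, add_comm k 2]
    norm_cast
  · rw [leadingCoeff_mul, leadingCoeff_mul, leadingCoeff_C, leadingCoeff_U_natCast, hXl,
      Lagrange.nodal_monic.leadingCoeff, mul_comm]
  · intro i hi
    rw [eval_mul, Lagrange.eval_nodal_at_node hi, mul_zero, eval_mul]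
    simpa using (node_sq_sub_one_mul_eval_U k i).symm

open Polynomial Polynomial.Chebyshev in
lemma nodalWeight_node {k i : ℕ} (hi : i ≤ k + 1) :
    Lagrange.nodalWeight (Finset.range (k + 2)) (node (k + 1)) i =
      2 ^ k / (k + 1) * (-1) ^ i * (if i = 0 ∨ i = k + 1 then 1 / 2 else 1) := by
  set x := node (k + 1) i with hx
  have hT : (T ℝ ((k + 1 : ℕ) : ℤ)).eval x = (-1) ^ i := eval_T_real_node (by simpa using hi)
  have hT' : derivative (T ℝ ((k + 1 : ℕ) : ℤ)) = (k + 1 : ℝ[X]) * U ℝ (k : ℤ) := by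
    rw [T_derivative_eq_U]; push_cast; simp
  have hode := one_sub_X_sq_mul_iterate_derivative_T_eval (R := ℝ) ((k + 1 : ℕ) : ℤ) 0 x
  simp only [Function.iterate_succ, Function.iterate_zero, Function.comp, id, hT'] at hode
  rw [hT] at hode
  have hnod := congrArg (fun P => (derivative P).eval x) (C_mul_nodal_node k)
  simp only [derivative_mul, derivative_C, zero_mul, zero_add, eval_mul, eval_C, eval_add,
    derivative_sub, derivative_one, derivative_X_pow, eval_sub, eval_pow, eval_X, eval_one,
    sub_zero] at hnod
  have hU := node_sq_sub_one_mul_eval_U k i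
  rw [← hx] at hU
  rw [Lagrange.nodalWeight_eq_eval_derivative_nodal (by simpa using by omega), ← hx]
  set D := (derivative (Lagrange.nodal (Finset.range (k + 2)) (node (k + 1)))).eval x
  simp only [derivative_mul, eval_mul, eval_add, derivative_add, derivative_natCast,
    derivative_one, eval_natCast, eval_one, eval_zero] at hode
  push_cast at hode hnod
  simp at hode hnod
  have hk : (k : ℝ) + 1 ≠ 0 := by positivity
  have hs : ((-1 : ℝ) ^ i) * (-1) ^ i = 1 := by rw [← mul_pow]; simp
  set u := (U ℝ (k : ℤ)).eval x
  set u' := (derivative (U ℝ (k : ℤ))).eval x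
  have hode' : (1 - x ^ 2) * u' = x * u - (k + 1) * (-1) ^ i := by
    apply mul_left_cancel₀ hk; linear_combination hode
  split_ifs with h
  · have hx2 : x ^ 2 = 1 := by
      rcases h with rfl | rfl
      · rw [hx, node_eq_one]; norm_num
      · rw [hx, node_eq_neg_one (by omega)]; norm_num
    rw [hx2] at hode'
    have hD : 2 ^ k * D = 2 * (k + 1) * (-1) ^ i := by
      rw [hnod, hx2]; linear_combination -2 * hode'
    rw [inv_eq_of_mul_eq_one_left]
    field_simp
    linear_combination (-1) ^ i * hD + 2 * (k + 1) * hs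
  · push Not at h
    have h1 : x < 1 := by
      rw [hx, ← node_eq_one (n := k + 1)]; exact node_lt hi (by omega)
    have h2 : -1 < x := by
      rw [hx, ← node_eq_neg_one (n := k + 1) (by omega)]; exact node_lt le_rfl (by omega)
    have hu : u = 0 := (mul_eq_zero.1 hU).resolve_left (by nlinarith)
    have hD : 2 ^ k * D = (k + 1) * (-1) ^ i := by
      rw [hnod]; linear_combination -hode' + x * hu
    rw [inv_eq_of_mul_eq_one_left]
    field_simp
    linear_combination (-1) ^ i * hD + (k + 1) * hs

open Polynomial.Chebyshev in
lemma sum_range_nodalWeight_node {k K : ℕ} (hK : K ≤ k + 1) :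
    ∑ i ∈ Finset.range K, Lagrange.nodalWeight (Finset.range (k + 2)) (node (k + 1)) i =
      2 ^ k / (k + 1) * if K = 0 then 0 else -(-1) ^ K / 2 := by
  induction K with
  | zero => simp
  | succ K ih =>
    rw [Finset.sum_range_succ, ih (by omega), nodalWeight_node (by omega)]
    rcases K with _ | K
    · simp
    · rw [if_neg (by omega), if_neg (by omega), if_neg (by omega)]
      ring

open Polynomial.Chebyshev in
lemma abs_sum_range_nodalWeight_node_le {k K : ℕ} (hK : K ≤ k + 2) :
    |∑ i ∈ Finset.range K, Lagrange.nodalWeight (Finset.range (k + 2)) (node (k + 1)) i| ≤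
      2 ^ k / (k + 1) / 2 := by
  have hpos : (0 : ℝ) ≤ 2 ^ k / (k + 1) := by positivity
  rcases hK.lt_or_eq with h | rfl
  · rw [sum_range_nodalWeight_node (by omega), abs_mul, abs_of_nonneg hpos,
      ← mul_one_div (_ / _) (2 : ℝ)]
    refine mul_le_mul_of_nonneg_left ?_ hpos
    split_ifs
    · norm_num
    · rw [abs_div, abs_neg, abs_neg_one_pow]; norm_num
  · have h := sum_nodalWeight_mul_sub_pow (n := 0) (strictAntiOn_node (k + 1)).injOn
      (Finset.card_range (k + 2)) (by omega) 0
    simp only [pow_zero, mul_one] at h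
    rw [h, if_neg (by omega), abs_zero]
    positivity

/-- The Chebyshev perfect spline of degree `k + 1` on `[-1, 1]` and its derivatives, up to
normalization. -/
noncomputable def chebSpline (k n : ℕ) (x : ℝ) : ℝ :=
  truncSpline (Finset.range (k + 2)) (Polynomial.Chebyshev.node (k + 1)) n x

open Polynomial.Chebyshev in
lemma abs_chebSpline_zero_le (k : ℕ) (x : ℝ) : |chebSpline k 0 x| ≤ 2 ^ k / (k + 1) / 2 := by
  obtain ⟨K, hK, h⟩ : ∃ K ≤ k + 2, ∀ i < k + 2, x < node (k + 1) i ↔ i < K := by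
    classical
    by_cases hex : ∃ i, i < k + 2 ∧ node (k + 1) i ≤ x
    · refine ⟨Nat.find hex, (Nat.find_spec hex).1.le, fun i hi => ⟨fun hxi => ?_, fun hiK => ?_⟩⟩
      · by_contra! hle
        have := (Nat.find_spec hex).2
        rcases hle.eq_or_lt with h | h
        · rw [h] at this; linarith
        · linarith [node_lt (n := k + 1) (by omega) h]
      · by_contra! hle
        exact Nat.find_min hex hiK ⟨hi, hle⟩
    · push Not at hex
      exact ⟨k + 2, le_rfl, fun i hi => ⟨fun _ => hi, fun _ => hex i hi⟩⟩
  convert abs_sum_range_nodalWeight_node_le hK using 2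
  unfold chebSpline truncSpline
  have hsub : Finset.range K ⊆ Finset.range (k + 2) := Finset.range_mono hK
  rw [← Finset.sum_subset hsub (fun i hi hiK => ?_)]
  · refine Finset.sum_congr rfl fun i hi => ?_
    have := (h i (Finset.mem_range.1 (hsub hi))).2 (Finset.mem_range.1 hi)
    simp [truncPow, this]
  · have := (h i (Finset.mem_range.1 hi)).not.2 (by simpa using hiK)
    simp [truncPow, this]

open Polynomial.Chebyshev in
lemma chebSpline_add_neg (k : ℕ) (x : ℝ) :
    chebSpline k (k + 1) x + chebSpline k (k + 1) (-x) = 1 := by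
  have h1 := sum_nodalWeight_mul_sub_pow (strictAntiOn_node (k + 1)).injOn
    (Finset.card_range (k + 2)) le_rfl x
  rw [if_pos rfl] at h1
  rw [← h1]
  unfold chebSpline truncSpline
  rw [← Finset.sum_range_reflect (n := k + 2)
    (f := fun i => Lagrange.nodalWeight _ _ i * truncPow _ (node (k + 1) i - -x)),
    ← Finset.sum_add_distrib]
  refine Finset.sum_congr rfl fun i hi => ?_
  have hi' : i ≤ k + 1 := by simpa [Nat.lt_succ_iff] using hi
  have he : k + 2 - 1 - i = k + 1 - i := by omega
  have hnode : node (k + 1) (k + 1 - i) = -node (k + 1) i := by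
    unfold node
    rw [← Real.cos_pi_sub, Nat.cast_sub hi']
    congr 1
    push_cast
    field_simp
  have hw : Lagrange.nodalWeight (Finset.range (k + 2)) (node (k + 1)) (k + 1 - i) =
      (-1) ^ (k + 1) * Lagrange.nodalWeight (Finset.range (k + 2)) (node (k + 1)) i := by
    rw [nodalWeight_node (by omega), nodalWeight_node hi']
    have hs : (-1 : ℝ) ^ (k + 1 - i) = (-1) ^ (k + 1) * (-1) ^ i := by
      rw [← pow_add, show k + 1 + i = k + 1 - i + 2 * i by omega, pow_add, pow_mul]; simp
    have hc : (k + 1 - i = 0 ∨ k + 1 - i = k + 1) ↔ (i = 0 ∨ i = k + 1) := by omega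
    simp only [hs, hc]
    ring
  rw [he, hw, hnode, ← truncPow_add_neg k (_ - x), show -node (k + 1) i - -x = -(node (k + 1) i - x) by ring, mul_add]
  congr 1
  ring

lemma iteratedDeriv_eq_of_hasDerivAt {F : ℕ → ℝ → ℝ} {k : ℕ}
    (hF : ∀ j < k, ∀ x, HasDerivAt (F j) (F (j + 1) x) x) {j : ℕ} (hj : j ≤ k) :
    iteratedDeriv j (F 0) = F j := by
  induction j with
  | zero => exact iteratedDeriv_zero
  | succ j ih =>
    rw [iteratedDeriv_succ, ih (by omega)]
    exact funext fun x => (hF j hj x).deriv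

lemma contDiff_of_hasDerivAt {F : ℕ → ℝ → ℝ} {k : ℕ}
    (hF : ∀ j < k, ∀ x, HasDerivAt (F j) (F (j + 1) x) x) (hk : Continuous (F k)) :
    ContDiff ℝ k (F 0) := by
  refine contDiff_nat_iff_iteratedDeriv.2 ⟨fun j hj => ?_, fun j hj => ?_⟩
  · rw [iteratedDeriv_eq_of_hasDerivAt hF hj]
    rcases hj.lt_or_eq with h | rfl
    · exact continuous_iff_continuousAt.2 fun x => (hF j h x).continuousAt
    · exact hk
  · rw [iteratedDeriv_eq_of_hasDerivAt hF hj.le]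
    exact fun x => (hF j hj x).differentiableAt

lemma Mc_pos (m : ℕ) : 0 < Mc m := by unfold Mc; positivity

lemma Mc_succ (k : ℕ) : Mc (k + 1) = (k + 1).factorial * (2 ^ k / (k + 1) / 2) := by
  unfold Mc
  rw [Nat.factorial_succ, Nat.add_sub_cancel,
    show ((k + 1 : ℕ) : ℤ) - 2 = (k : ℤ) - 1 by push_cast; ring, zpow_sub₀ two_ne_zero]
  push_cast
  rw [zpow_natCast, zpow_one]
  field_simp

/-- The `j`-th derivative of the rescaled Chebyshev perfect spline. -/
noncomputable def scaledSplineDeriv (k : ℕ) (β y : ℝ) (j : ℕ) (x : ℝ) : ℝ :=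
  (-1) ^ j * β ^ (k + 1 - j) / Mc (k + 1) * (k + 1).descFactorial j *
    chebSpline k (k + 1 - j) ((x - y) / β)

lemma hasDerivAt_scaledSplineDeriv {k j : ℕ} (hj : j < k) {β : ℝ} (hβ : β ≠ 0) (y x : ℝ) :
    HasDerivAt (scaledSplineDeriv k β y j) (scaledSplineDeriv k β y (j + 1) x) x := by
  obtain ⟨n, rfl⟩ : ∃ n, k = j + n + 1 := ⟨k - j - 1, by omega⟩
  have e1 : j + n + 1 + 1 - j = n + 2 := by omega
  have e2 : j + n + 1 + 1 - (j + 1) = n + 1 := by omega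
  have h1 : HasDerivAt (fun x : ℝ => (x - y) / β) (1 / β) x :=
    ((hasDerivAt_id x).sub_const y).div_const β
  have h2 := ((hasDerivAt_truncSpline (Finset.range (j + n + 1 + 2))
    (Polynomial.Chebyshev.node (j + n + 1 + 1)) n ((x - y) / β)).comp x h1).const_mul
    ((-1) ^ j * β ^ (n + 2) / Mc (j + n + 1 + 1) * (j + n + 1 + 1).descFactorial j)
  unfold scaledSplineDeriv
  rw [e1, e2, Nat.descFactorial_succ, e1]
  refine h2.congr_deriv ?_
  unfold chebSpline
  push_cast
  field_simp
  ring

lemma testFun_scaled_chebSpline (k : ℕ) {β : ℝ} (hβ : 0 < β) (hβ2 : β ≤ 1 / 2) (y : ℝ) :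
    testFun (k + 1) fun x => β ^ (k + 1) / Mc (k + 1) * chebSpline k (k + 1) ((x - y) / β) := by
  have hM := Mc_pos (k + 1)
  have hzero : (fun x => β ^ (k + 1) / Mc (k + 1) * chebSpline k (k + 1) ((x - y) / β)) =
      scaledSplineDeriv k β y 0 := by
    funext x; simp [scaledSplineDeriv]
  have hderiv : ∀ j < k, ∀ x, HasDerivAt (scaledSplineDeriv k β y j)
      (scaledSplineDeriv k β y (j + 1) x) x :=
    fun j hj x => hasDerivAt_scaledSplineDeriv hj hβ.ne' y x
  have hcard : (Finset.range (k + 2)).card = (k + 1) + 1 := by simp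
  have hinj := (Polynomial.Chebyshev.strictAntiOn_node (k + 1)).injOn
  have e : k + 1 - k = 1 := by omega
  have hlast : scaledSplineDeriv k β y k = fun x => (-1) ^ k * β / Mc (k + 1) *
      (k + 1).factorial * chebSpline k 1 ((x - y) / β) := by
    funext x
    have h := Nat.factorial_mul_descFactorial (n := k + 1) (k := k) (by omega)
    rw [e, Nat.factorial_one, one_mul] at h
    simp only [scaledSplineDeriv, e, h, pow_one]
  have hcont : Continuous (chebSpline k 1) := continuous_truncSpline _ _ 0
  rw [hzero, testFun, Nat.add_sub_cancel]
  refine ⟨contDiff_of_hasDerivAt hderiv ?_, fun j hj x => ?_, ?_⟩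
  · rw [hlast]; fun_prop
  · rw [iteratedDeriv_eq_of_hasDerivAt hderiv hj]
    unfold scaledSplineDeriv
    have hb : (0 : ℝ) ≤ β ^ (k + 1 - j) / Mc (k + 1) * (k + 1).descFactorial j := by positivity
    rw [abs_mul, mul_div_assoc, mul_assoc ((-1) ^ j), abs_mul, abs_neg_one_pow, one_mul,
      abs_of_nonneg hb]
    rcases j with _ | j
    · have hmem := truncSpline_mem_Icc hinj hcard ((x - y) / β)
      have h1 : |chebSpline k (k + 1 - 0) ((x - y) / β)| ≤ 1 := by
        exact (abs_of_nonneg hmem.1).trans_le hmem.2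
      refine mul_le_one₀ ?_ (abs_nonneg _) h1
      simp only [Nat.sub_zero, Nat.descFactorial_zero, Nat.cast_one, mul_one]
      rw [div_le_one hM]
      calc β ^ (k + 1) ≤ β ^ 1 := pow_le_pow_of_le_one hβ.le (by linarith) (by omega)
        _ ≤ 1 / 2 := by simpa using hβ2
        _ ≤ 1 / 2 * (2 ^ k * k.factorial) := by
          have h1 : (1 : ℝ) ≤ 2 ^ k := one_le_pow₀ (by norm_num)
          have h2 : (1 : ℝ) ≤ k.factorial := by exact_mod_cast Nat.succ_le_of_lt k.factorial_pos
          nlinarith [mul_le_mul h1 h2 (by norm_num) (by positivity)]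
        _ = Mc (k + 1) := by
          rw [Mc_succ, Nat.factorial_succ]; push_cast; field_simp
    · have h := abs_truncSpline_le hinj hcard
        (fun i _ => Polynomial.Chebyshev.node_mem_Icc) (by positivity)
        (abs_chebSpline_zero_le k) (n := k + 1 - (j + 1)) (by omega) ((x - y) / β)
      have hfac := Nat.factorial_mul_descFactorial (n := k + 1) (k := j + 1) (by omega)
      set n := k + 1 - (j + 1)
      have hfac' : (n.factorial : ℝ) * (k + 1).descFactorial (j + 1) = (k + 1).factorial := by
        exact_mod_cast hfac
      calc _ ≤ β ^ n / Mc (k + 1) * (k + 1).descFactorial (j + 1) *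
            (2 ^ n * n.factorial * (2 ^ k / (k + 1) / 2)) := mul_le_mul_of_nonneg_left h hb
        _ = (2 * β) ^ n * (Mc (k + 1) / Mc (k + 1)) := by
          conv_rhs => enter [2, 1]; rw [Mc_succ k, ← hfac']
          ring
        _ ≤ 1 := by
          rw [div_self hM.ne', mul_one]
          exact pow_le_one₀ (by positivity) (by linarith)
  · rw [iteratedDeriv_eq_of_hasDerivAt hderiv le_rfl, hlast]
    refine LipschitzWith.of_dist_le_mul fun a b => ?_
    have h := abs_truncSpline_sub_le (abs_chebSpline_zero_le k) ((a - y) / β) ((b - y) / β)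
    rw [Real.dist_eq, Real.dist_eq, ← mul_sub, abs_mul, mul_div_assoc, mul_assoc ((-1) ^ k),
      abs_mul, abs_neg_one_pow, one_mul, abs_of_nonneg (by positivity), NNReal.coe_one, one_mul]
    rw [← sub_div, sub_sub_sub_cancel_right, abs_div, abs_of_pos hβ] at h
    calc _ ≤ _ := mul_le_mul_of_nonneg_left h (by positivity)
      _ = (Mc (k + 1) / Mc (k + 1)) * |a - b| := by
        conv_rhs => enter [1, 1]; rw [Mc_succ k]
        push_cast
        field_simp
        ring
      _ = |a - b| := by rw [div_self hM.ne', one_mul]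

lemma abs_integral_sub_le_dSm {m : ℕ} {μ ν : Measure ℝ} [IsProbabilityMeasure μ]
    [IsProbabilityMeasure ν] {f : ℝ → ℝ} (hf : testFun m f) :
    |(∫ x, f x ∂μ) - ∫ x, f x ∂ν| ≤ dSm m μ ν := by
  have hb : ∀ (ρ : Measure ℝ) [IsProbabilityMeasure ρ] (g : ℝ → ℝ), testFun m g →
      |∫ x, g x ∂ρ| ≤ 1 := fun ρ _ g hg => by
    have h1 : ∀ x, |g x| ≤ 1 := fun x => by simpa using hg.2.1 0 (Nat.zero_le _) x
    simpa using norm_integral_le_of_norm_le_const (μ := ρ) (f := g) (C := 1)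
      (Filter.Eventually.of_forall h1)
  refine le_ciSup (f := fun h : {h : ℝ → ℝ // testFun m h} =>
    |(∫ x, h.1 x ∂μ) - ∫ x, h.1 x ∂ν|) ⟨2, ?_⟩ ⟨f, hf⟩
  rintro _ ⟨⟨g, hg⟩, rfl⟩
  have := abs_sub (∫ x, g x ∂μ) (∫ x, g x ∂ν)
  have := hb μ g hg
  have := hb ν g hg
  simp only
  linarith

lemma setIntegral_withDensity_le {A : ℝ} (hA : 0 ≤ A) {p : ℝ → ℝ} (hp : ∀ y, p y ≤ A)
    {g : ℝ → ℝ} (hg : Continuous g) (hg0 : ∀ x, 0 ≤ g x) (a b : ℝ) :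
    ∫ x in Set.Ioc a b, g x ∂(volume.withDensity fun y => ENNReal.ofReal (p y)) ≤
      A * ∫ x in Set.Ioc a b, g x := by
  have hle : volume.withDensity (fun y => ENNReal.ofReal (p y)) ≤
      ENNReal.ofReal A • (volume : Measure ℝ) := by
    rw [← withDensity_const]
    exact withDensity_mono (Filter.Eventually.of_forall fun y => ENNReal.ofReal_le_ofReal (hp y))
  have hint : Integrable g (volume.restrict (Set.Ioc a b)) :=
    (hg.integrableOn_Icc (a := a) (b := b)).mono_set Set.Ioc_subset_Icc_self
  calc _ ≤ ∫ x in Set.Ioc a b, g x ∂(ENNReal.ofReal A • (volume : Measure ℝ)) := by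
        refine integral_mono_measure (Measure.restrict_mono le_rfl hle)
          (Filter.Eventually.of_forall hg0) ?_
        rw [Measure.restrict_smul]
        exact hint.smul_measure ENNReal.ofReal_ne_top
    _ = _ := by
        rw [Measure.restrict_smul, integral_smul_measure, ENNReal.toReal_ofReal hA, smul_eq_mul]

/-- The decreasing Chebyshev perfect spline rescaled to `[y - β, y + β]`. -/
noncomputable def smoothStep (k : ℕ) (β y x : ℝ) : ℝ := chebSpline k (k + 1) ((x - y) / β)

lemma continuous_smoothStep (k : ℕ) (β y : ℝ) : Continuous (smoothStep k β y) := by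
  have : Continuous (chebSpline k (k + 1)) := continuous_truncSpline _ _ k
  unfold smoothStep
  fun_prop

lemma smoothStep_mem_Icc (k : ℕ) (β y x : ℝ) : smoothStep k β y x ∈ Set.Icc 0 1 :=
  truncSpline_mem_Icc (Polynomial.Chebyshev.strictAntiOn_node (k + 1)).injOn
    (Finset.card_range (k + 2)) _

lemma smoothStep_of_le (k : ℕ) {β y x : ℝ} (hβ : 0 < β) (h : x ≤ y - β) :
    smoothStep k β y x = 1 := by
  have h1 : (x - y) / β ≤ -1 := by rw [div_le_iff₀ hβ]; linarith
  exact (truncSpline_of_ge (Polynomial.Chebyshev.strictAntiOn_node (k + 1)).injOn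
    (Finset.card_range (k + 2)) le_rfl fun i _ =>
      h1.trans Polynomial.Chebyshev.node_mem_Icc.1).trans (if_pos rfl)

lemma smoothStep_of_ge (k : ℕ) {β y x : ℝ} (hβ : 0 < β) (h : y + β ≤ x) :
    smoothStep k β y x = 0 := by
  have h1 : 1 ≤ (x - y) / β := by rw [le_div_iff₀ hβ]; linarith
  exact truncSpline_of_le (s := Finset.range (k + 2)) (fun i _ => Polynomial.Chebyshev.node_mem_Icc.2.trans h1) _

lemma integral_smoothStep (k : ℕ) {β : ℝ} (hβ : 0 < β) (y : ℝ) :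
    ∫ x in Set.Ioc (y - β) (y + β), smoothStep k β y x = β := by
  have hint : ∀ a b, IntervalIntegrable (smoothStep k β y) volume a b :=
    fun a b => (continuous_smoothStep k β y).intervalIntegrable a b
  have hsymm : ∀ x, smoothStep k β y (2 * y - x) = 1 - smoothStep k β y x := fun x => by
    have := chebSpline_add_neg k ((x - y) / β)
    unfold smoothStep
    rw [show (2 * y - x - y) / β = -((x - y) / β) by ring]
    linarith
  have h := intervalIntegral.integral_comp_sub_left (a := y - β) (b := y + β)
    (smoothStep k β y) (2 * y)
  simp only [hsymm] at h
  rw [intervalIntegral.integral_sub (by simp) (hint _ _), intervalIntegral.integral_const,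
    show 2 * y - (y + β) = y - β by ring, show 2 * y - (y - β) = y + β by ring, smul_eq_mul] at h
  rw [← intervalIntegral.integral_of_le (by linarith)]
  linarith

lemma integrable_smoothStep (k : ℕ) (β y : ℝ) (ρ : Measure ℝ) [IsFiniteMeasure ρ] :
    Integrable (smoothStep k β y) ρ := by
  refine Integrable.of_bound (continuous_smoothStep k β y).aestronglyMeasurable 1
    (Filter.Eventually.of_forall fun x => ?_)
  have h := smoothStep_mem_Icc k β y x
  rw [Real.norm_eq_abs, abs_of_nonneg h.1]
  exact h.2

lemma abs_integral_smoothStep_sub_le (k : ℕ) {β : ℝ} (hβ : 0 < β) (hβ2 : β ≤ 1 / 2) (y : ℝ)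
    (μ ν : Measure ℝ) [IsProbabilityMeasure μ] [IsProbabilityMeasure ν] :
    |(∫ x, smoothStep k β y x ∂μ) - ∫ x, smoothStep k β y x ∂ν| ≤
      Mc (k + 1) * dSm (k + 1) μ ν / β ^ (k + 1) := by
  have h := abs_integral_sub_le_dSm (μ := μ) (ν := ν) (testFun_scaled_chebSpline k hβ hβ2 y)
  have hM := Mc_pos (k + 1)
  rw [integral_const_mul, integral_const_mul, ← mul_sub, abs_mul,
    abs_of_pos (by positivity)] at h
  rw [le_div_iff₀ (by positivity), ← div_le_iff₀' hM]
  calc _ = _ := by rw [mul_comm]; exact (mul_div_right_comm _ _ _)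
    _ ≤ _ := h

lemma measureReal_Iic_le_integral_smoothStep (k : ℕ) {β : ℝ} (hβ : 0 < β) (z : ℝ)
    (ρ : Measure ℝ) [IsFiniteMeasure ρ] :
    ρ.real (Set.Iic z) ≤ ∫ x, smoothStep k β (z + β) x ∂ρ := by
  rw [← integral_indicator_one measurableSet_Iic]
  refine integral_mono ((integrable_const _).indicator measurableSet_Iic)
    (integrable_smoothStep ..) fun x => ?_
  by_cases hx : x ∈ Set.Iic z
  · rw [Set.indicator_of_mem hx, smoothStep_of_le k hβ (by simpa using hx)]; rfl
  · rw [Set.indicator_of_notMem hx]; exact (smoothStep_mem_Icc ..).1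

lemma integral_smoothStep_le_measureReal_Iic (k : ℕ) {β : ℝ} (hβ : 0 < β) (z : ℝ)
    (ρ : Measure ℝ) [IsFiniteMeasure ρ] :
    ∫ x, smoothStep k β (z - β) x ∂ρ ≤ ρ.real (Set.Iic z) := by
  rw [← integral_indicator_one measurableSet_Iic]
  refine integral_mono (integrable_smoothStep ..)
    ((integrable_const _).indicator measurableSet_Iic) fun x => ?_
  by_cases hx : x ∈ Set.Iic z
  · rw [Set.indicator_of_mem hx]; exact (smoothStep_mem_Icc ..).2
  · rw [Set.indicator_of_notMem hx, smoothStep_of_ge k hβ]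
    simpa using (not_le.1 hx).le

lemma integral_smoothStep_eq (k : ℕ) {β : ℝ} (hβ : 0 < β) (y : ℝ) (ρ : Measure ℝ)
    [IsFiniteMeasure ρ] :
    ∫ x, smoothStep k β y x ∂ρ =
      ρ.real (Set.Iic (y - β)) + ∫ x in Set.Ioc (y - β) (y + β), smoothStep k β y x ∂ρ := by
  have hint : Integrable ((Set.Iic (y - β)).indicator (1 : ℝ → ℝ)) ρ :=
    (integrable_const (1 : ℝ)).indicator measurableSet_Iic
  rw [← integral_indicator_one measurableSet_Iic, ← integral_indicator measurableSet_Ioc,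
    ← integral_add hint
      ((integrable_smoothStep ..).indicator measurableSet_Ioc)]
  congr 1 with x
  simp only [Set.indicator_apply, Set.mem_Iic, Set.mem_Ioc, Pi.one_apply]
  rcases le_or_gt x (y - β) with h | h
  · rw [smoothStep_of_le k hβ h]; simp [h, h.not_gt]
  · rcases le_or_gt x (y + β) with h2 | h2
    · simp [h, h.not_ge, h2]
    · rw [smoothStep_of_ge k hβ h2.le]; simp [h.not_ge]

lemma abs_measureReal_Iic_sub_le (k : ℕ) {A : ℝ} (hA : 0 ≤ A) (μ : Measure ℝ)
    [IsProbabilityMeasure μ] {p : ℝ → ℝ} (hp : ∀ y, p y ≤ A)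
    [IsProbabilityMeasure (volume.withDensity fun y => ENNReal.ofReal (p y))]
    {β : ℝ} (hβ : 0 < β) (hβ2 : β ≤ 1 / 2) (z : ℝ) :
    |μ.real (Set.Iic z) -
        (volume.withDensity fun y => ENNReal.ofReal (p y)).real (Set.Iic z)| ≤
      Mc (k + 1) * dSm (k + 1) μ (volume.withDensity fun y => ENNReal.ofReal (p y)) /
        β ^ (k + 1) + A * β := by
  set ν := volume.withDensity fun y => ENNReal.ofReal (p y) with hν
  rw [abs_le]
  constructor
  · have h1 := (abs_le.1 (abs_integral_smoothStep_sub_le k hβ hβ2 (z - β) μ ν)).1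
    have h2 := integral_smoothStep_le_measureReal_Iic k hβ z μ
    have h3 := integral_smoothStep_eq k hβ (z - β) ν
    have h4 := setIntegral_withDensity_le hA hp
      (g := fun x => 1 - smoothStep k β (z - β) x)
      (continuous_const.sub (continuous_smoothStep ..))
      (fun x => sub_nonneg.2 (smoothStep_mem_Icc ..).2) (z - β - β) (z - β + β)
    have hI : IntegrableOn (smoothStep k β (z - β)) (Set.Ioc (z - β - β) (z - β + β)) :=
      integrable_smoothStep ..
    rw [← hν, integral_sub (integrable_const _) (integrable_smoothStep ..),
      integral_sub (integrable_const _) hI, integral_smoothStep k hβ] at h4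
    have h5 : ν.real (Set.Iic z) =
        ν.real (Set.Iic (z - β - β)) + ν.real (Set.Ioc (z - β - β) (z - β + β)) := by
      rw [← measureReal_union (Set.Iic_disjoint_Ioc le_rfl) measurableSet_Ioc,
        Set.Iic_union_Ioc_eq_Iic (by linarith), sub_add_cancel]
    simp only [integral_const, measureReal_restrict_apply_univ, smul_eq_mul, mul_one,
      Real.volume_real_Ioc] at h4
    rw [max_eq_left (by linarith), show z - β + β - (z - β - β) - β = β by ring] at h4
    linarith
  · have h1 := (abs_le.1 (abs_integral_smoothStep_sub_le k hβ hβ2 (z + β) μ ν)).2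
    have h2 := measureReal_Iic_le_integral_smoothStep k hβ z μ
    have h3 := integral_smoothStep_eq k hβ (z + β) ν
    have h4 := setIntegral_withDensity_le hA hp (continuous_smoothStep k β (z + β))
      (fun x => (smoothStep_mem_Icc ..).1) (z + β - β) (z + β + β)
    rw [← hν, integral_smoothStep k hβ] at h4
    rw [add_sub_cancel_right] at h3 h4
    linarith

theorem kolmogorov_le_of_bounded_density
    (m : ℕ) (hm : 1 ≤ m) (A : ℝ) (hA : 0 < A)
    (μ ν : Measure ℝ) [IsProbabilityMeasure μ] [IsProbabilityMeasure ν]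
    (p : ℝ → ℝ) (hp0 : ∀ x, 0 ≤ p x)
    (hpdf : ν = volume.withDensity (fun y => ENNReal.ofReal (p y)))
    (hbd : ∀ y, p y ≤ A)
    (hdm : dSm m μ ν ≤ A / (2 * Nc m)) :
    dKol μ ν ≤ 2 * (A ^ m * Mc m * dSm m μ ν) ^ ((1 : ℝ) / (m + 1)) := by
  obtain ⟨k, rfl⟩ : ∃ k, m = k + 1 := ⟨m - 1, by omega⟩
  subst hpdf
  set ν := volume.withDensity fun y => ENNReal.ofReal (p y)
  have hM := Mc_pos (k + 1)
  have hd : 0 ≤ dSm (k + 1) μ ν := Real.iSup_nonneg fun _ => abs_nonneg _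
  set d := dSm (k + 1) μ ν
  set r := (A ^ (k + 1) * Mc (k + 1) * d) ^ ((1 : ℝ) / ((k + 1 : ℕ) + 1)) with hr
  have hr0 : 0 ≤ r := by positivity
  have hrpow : r ^ (k + 2) = A ^ (k + 1) * Mc (k + 1) * d := by
    rw [hr, ← Real.rpow_natCast, ← Real.rpow_mul (by positivity)]
    push_cast
    rw [show (1 : ℝ) / ((k : ℝ) + 1 + 1) * (k + 2) = 1 by field_simp; ring, Real.rpow_one]
  have hrle : r ≤ A / 2 := by
    refine le_of_pow_le_pow_left₀ (n := k + 2) (by omega) (by positivity) ?_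
    rw [hrpow]
    calc _ ≤ A ^ (k + 1) * Mc (k + 1) * (A / (2 * Nc (k + 1))) := by gcongr
      _ = _ := by unfold Nc; rw [div_pow]; field_simp; ring
  refine Real.iSup_le (fun z => ?_) (by positivity)
  have key : ∀ β, 0 < β → β ≤ 1 / 2 → |(μ (Set.Iic z)).toReal - (ν (Set.Iic z)).toReal| ≤
      Mc (k + 1) * d / β ^ (k + 1) + A * β :=
    fun β hβ hβ2 => abs_measureReal_Iic_sub_le k hA.le μ hbd hβ hβ2 z
  rcases hr0.eq_or_lt with h0 | hpos
  · have hd0 : d = 0 := by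
      rw [← h0, zero_pow (by omega)] at hrpow
      exact (mul_eq_zero.1 hrpow.symm).resolve_left (by positivity)
    rw [← h0, mul_zero]
    refine le_of_forall_pos_le_add fun ε hε => ?_
    have h := key (min (1 / 2) (ε / A)) (by positivity) (min_le_left _ _)
    rw [hd0, mul_zero, zero_div, zero_add] at h
    calc _ ≤ _ := h
      _ ≤ A * (ε / A) := by gcongr; exact min_le_right _ _
      _ = 0 + ε := by field_simp; ring
  · have h := key (r / A) (by positivity) (by rw [div_le_iff₀ hA]; linarith)
    have e1 : Mc (k + 1) * d / (r / A) ^ (k + 1) = r := by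
      rw [div_pow, div_div_eq_mul_div, div_eq_iff (by positivity)]
      linear_combination -hrpow
    rw [e1, mul_div_cancel₀ _ hA.ne'] at h
    linarith
end

section
/- Let k ≥ 0 and r ≥ 4 be integers. Then there does not exist a constant C_{k,r} > 0 such that, for all functions h: ℝ → ℝ whose k-th derivative h^{(k)} is Lipschitz, the solution f_h of the standard normal Stein equation is (k+r)-times differentiable with ‖f_h^{(k+r)}‖ ≤ C_{k,r} ‖h^{(k+1)}‖. -/
open MeasureTheory ProbabilityTheory Real
open scoped NNReal

/-- The solution of the standard normal Stein equation
`f'(x) - x f(x) = h(x) - E[h(Z)]`, `Z ~ N(0,1)`. -/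
noncomputable def steinSol (h : ℝ → ℝ) : ℝ → ℝ := fun x =>
  Real.exp (x ^ 2 / 2) *
    ∫ t in Set.Iic x, Real.exp (-t ^ 2 / 2) * (h t - ∫ z, h z ∂(gaussianReal 0 1))

lemma hasDerivAt_mul_abs (x : ℝ) : HasDerivAt (fun y : ℝ => y * |y|) (2 * |x|) x := by
  rcases eq_or_ne x 0 with rfl | hx
  · rw [hasDerivAt_iff_tendsto_slope_zero]
    have h : Filter.Tendsto (fun t : ℝ => |t|) (nhdsWithin 0 {0}ᶜ) (nhds (2 * |(0 : ℝ)|)) := by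
      have := (continuous_abs.tendsto (0 : ℝ)).mono_left
        (nhdsWithin_le_nhds (s := ({0}ᶜ : Set ℝ)))
      simpa using this
    refine h.congr' ?_
    filter_upwards [self_mem_nhdsWithin] with t ht
    have ht' : t ≠ 0 := ht
    simp [ht']
  · have h := (hasDerivAt_id x).mul (hasDerivAt_abs hx)
    have e : x * (SignType.sign x : ℝ) = |x| := by
      rcases hx.lt_or_gt with h | h
      · simp [h, abs_of_neg]
      · simp [h, abs_of_pos]
    refine h.congr_deriv ?_
    simp only [id, one_mul, e]
    ring

lemma hasDerivAt_pow_mul_abs (k : ℕ) (x : ℝ) :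
    HasDerivAt (fun y : ℝ => y ^ (k + 1) * |y|) ((k + 2) * (x ^ k * |x|)) x := by
  have h := (hasDerivAt_pow k x).mul (hasDerivAt_mul_abs x)
  have e : (fun y : ℝ => y ^ (k + 1) * |y|) = (fun y => y ^ k) * fun y => y * |y| := by
    ext y
    simp only [Pi.mul_apply]
    ring
  rw [e]
  refine h.congr_deriv ?_
  rcases k with _ | k
  · simp
  · push_cast
    ring

lemma deriv_pow_mul_abs (k : ℕ) :
    deriv (fun y : ℝ => y ^ (k + 1) * |y|) = fun x => ((k : ℝ) + 2) * (x ^ k * |x|) :=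
  funext fun x => (hasDerivAt_pow_mul_abs k x).deriv

lemma contDiff_pow_mul_abs (k : ℕ) : ContDiff ℝ k (fun y : ℝ => y ^ k * |y|) := by
  induction k with
  | zero => simpa using continuous_abs
  | succ k ih =>
    push_cast
    rw [contDiff_succ_iff_deriv]
    refine ⟨fun x => (hasDerivAt_pow_mul_abs k x).differentiableAt, by simp, ?_⟩
    rw [deriv_pow_mul_abs]
    exact contDiff_const.mul ih

lemma iteratedDeriv_pow_mul_abs (k : ℕ) :
    iteratedDeriv k (fun y : ℝ => y ^ k * |y|) = fun x => ((k + 1).factorial : ℝ) * |x| := by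
  induction k with
  | zero => ext x; simp
  | succ k ih =>
    rw [iteratedDeriv_succ', deriv_pow_mul_abs]
    ext x
    rw [iteratedDeriv_const_mul_field, ih, Nat.factorial_succ (k + 1)]
    push_cast
    ring

lemma integrable_exp_neg_sq_mul_pow_mul_abs_sub (k : ℕ) (c : ℝ) :
    Integrable (fun t : ℝ => Real.exp (-t ^ 2 / 2) * (t ^ k * |t| - c)) := by
  have h1 := (integrable_rpow_mul_exp_neg_mul_sq (b := 1 / 2) (by norm_num)
    (s := ((k + 1 : ℕ) : ℝ)) (by push_cast; linarith [k.cast_nonneg (α := ℝ)])).norm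
  have h0 := (integrable_exp_neg_mul_sq (b := 1 / 2) (by norm_num)).const_mul c
  have h2 : Integrable (fun t : ℝ => Real.exp (-t ^ 2 / 2) * (t ^ k * |t|)) := by
    refine h1.mono' (Continuous.aestronglyMeasurable (by fun_prop)) (.of_forall fun t => ?_)
    simp only [Real.rpow_natCast, norm_mul, norm_pow, Real.norm_eq_abs, Real.abs_exp, abs_abs]
    rw [show -(1 / 2 : ℝ) * t ^ 2 = -t ^ 2 / 2 by ring]
    exact le_of_eq (by ring)
  refine (h2.sub h0).congr (.of_forall fun t => ?_)
  simp only [Pi.sub_apply]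
  rw [show -(1 / 2 : ℝ) * t ^ 2 = -t ^ 2 / 2 by ring]
  ring

/-- `steinSol h` solves the Stein equation. -/
lemma hasDerivAt_steinSol {h : ℝ → ℝ} (hc : Continuous h)
    (hi : Integrable (fun t : ℝ => Real.exp (-t ^ 2 / 2) * (h t - ∫ z, h z ∂(gaussianReal 0 1))))
    (x : ℝ) :
    HasDerivAt (steinSol h) (x * steinSol h x + (h x - ∫ z, h z ∂(gaussianReal 0 1))) x := by
  unfold steinSol
  set c := ∫ z, h z ∂(gaussianReal 0 1)
  set g : ℝ → ℝ := fun t => Real.exp (-t ^ 2 / 2) * (h t - c) with hg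
  have hgc : Continuous g := by fun_prop
  have hint : HasDerivAt (fun y => ∫ t in Set.Iic y, g t) (g x) x := by
    have e : (fun y => ∫ t in Set.Iic y, g t) =
        fun y => (∫ t in Set.Iic 0, g t) + ∫ t in (0 : ℝ)..y, g t := by
      ext y
      rw [← intervalIntegral.integral_Iic_sub_Iic hi.integrableOn hi.integrableOn]
      ring
    rw [e]
    exact (intervalIntegral.integral_hasDerivAt_right (hgc.intervalIntegrable _ _)
      (hgc.stronglyMeasurableAtFilter _ _) hgc.continuousAt).const_add _
  have hexp : HasDerivAt (fun y : ℝ => Real.exp (y ^ 2 / 2)) (Real.exp (x ^ 2 / 2) * x) x := by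
    refine (((hasDerivAt_pow 2 x).div_const 2).exp).congr_deriv ?_
    simp
  refine (hexp.mul hint).congr_deriv ?_
  have hone : Real.exp (x ^ 2 / 2) * Real.exp (-x ^ 2 / 2) = 1 := by
    rw [← Real.exp_add, ← Real.exp_zero]
    congr 1
    ring
  simp only [hg]
  linear_combination (h x - c) * hone

/-- For `k ≥ 0` and `r ≥ 4`, there is no constant `C > 0` such that, for every `h : ℝ → ℝ`
whose `k`-th derivative is Lipschitz, the solution `f_h` of the standard normal Stein
equation is `(k+r)`-times differentiable with `‖f_h^(k+r)‖ ≤ C ‖h^(k+1)‖`, where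
`‖h^(k+1)‖` denotes the Lipschitz constant of `h^(k)`. -/
theorem no_uniform_bound_on_stein_solution_derivatives (k r : ℕ) (hr : 4 ≤ r) :
    ¬ ∃ C : ℝ, 0 < C ∧ ∀ (h : ℝ → ℝ) (L : ℝ≥0),
      ContDiff ℝ (↑k) h → LipschitzWith L (iteratedDeriv k h) →
      ((∀ i < k + r, Differentiable ℝ (iteratedDeriv i (steinSol h))) ∧
        ∀ x, |iteratedDeriv (k + r) (steinSol h) x| ≤ C * L) := by
  rintro ⟨C, -, hC⟩
  set h : ℝ → ℝ := fun y => y ^ k * |y| with hh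
  set c := ∫ z, h z ∂(gaussianReal 0 1) with hc
  have hlip : LipschitzWith ((k + 1).factorial : ℝ≥0) (iteratedDeriv k h) := by
    rw [hh, iteratedDeriv_pow_mul_abs]
    refine LipschitzWith.of_dist_le_mul fun x y => ?_
    rw [Real.dist_eq, Real.dist_eq, ← mul_sub, abs_mul, Nat.abs_cast, NNReal.coe_natCast]
    exact mul_le_mul_of_nonneg_left (abs_abs_sub_abs_le x y) (Nat.cast_nonneg _)
  obtain ⟨hdiff, -⟩ := hC h _ (contDiff_pow_mul_abs k) hlip
  have hf : ContDiff ℝ ((k + 1 : ℕ) + 1) (steinSol h) := by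
    have := contDiff_of_differentiable_iteratedDeriv (n := ((k + 2 : ℕ) : ℕ∞))
      (f := steinSol h) fun m hm => hdiff m (by
        have : m ≤ k + 2 := by exact_mod_cast hm
        omega)
    exact_mod_cast this
  have hstein : h = fun x => deriv (steinSol h) x - x * steinSol h x + c := by
    ext x
    rw [(hasDerivAt_steinSol (by fun_prop)
      (integrable_exp_neg_sq_mul_pow_mul_abs_sub k c) x).deriv]
    ring
  have hsmooth : ContDiff ℝ (k + 1 : ℕ) h := by
    rw [hstein]
    exact (((contDiff_succ_iff_deriv.1 hf).2.2).sub
      (contDiff_id.mul (hf.of_le le_self_add))).add contDiff_const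
  have hd : Differentiable ℝ (iteratedDeriv k h) :=
    hsmooth.differentiable_iteratedDeriv k (by exact_mod_cast Nat.lt_succ_self k)
  rw [hh, iteratedDeriv_pow_mul_abs] at hd
  refine not_differentiableAt_abs_zero
    (((hd 0).const_mul ((k + 1).factorial : ℝ)⁻¹).congr_of_eventuallyEq (.of_forall fun x => ?_))
  field_simp
end
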